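/- There exists an absolute constant C > 0 such that for every 1 ≤ p ≤ ∞, every real sequence β̄ = (β_k), and every r > 1 and n ∈ ℕ with r ≥ n+1, one has | n^r Ẽ_n(W^r_{β̄,1})_{L_p} − (2^{1−1/p}/π^{1+1/p}) ‖cos t‖_p^2 | ≤ C ( 1/n + e^{−r/(n+1)} ). -/

import Mathlib

open MeasureTheory Real Set
open scoped ENNReal

/-- The `L_p` "norm" of a (2π-periodic) function over one period `(0, 2π]`. -/
noncomputable def LpNormPer (p : ℝ≥0∞) (f : ℝ → ℝ) : ℝ :=
  (eLpNorm f p (volume.restrict (Ioc (0:ℝ) (2*π)))).toReal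

/-- `‖cos t‖_p` over one period. -/
noncomputable def cosLp (p : ℝ≥0∞) : ℝ := LpNormPer p Real.cos

/-- `T` is a trigonometric polynomial of order (degree) at most `m`. -/
def IsTrigPolyDeg (m : ℕ) (T : ℝ → ℝ) : Prop :=
  ∃ a b : ℕ → ℝ, ∀ x : ℝ, T x = a 0 / 2 +
    ∑ k ∈ Finset.Icc 1 m, (a k * Real.cos (k * x) + b k * Real.sin (k * x))

/-- Admissible `φ`: 2π-periodic, integrable on a period, `φ ⊥ 1`, `‖φ‖₁ ≤ 1`. -/
def AdmPhi (φ : ℝ → ℝ) : Prop :=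
  (∀ t : ℝ, φ (t + 2*π) = φ t) ∧ IntegrableOn φ (Ioc (0:ℝ) (2*π)) volume ∧
  (∫ t in (0:ℝ)..(2*π), φ t) = 0 ∧ (∫ t in (0:ℝ)..(2*π), |φ t|) ≤ 1

/-- The generating kernel `Ψ_β̄(t) = Σ_{k≥1} ψ(k) cos(kt − πβ_k/2)`. -/
noncomputable def ker1 (ψ βb : ℕ → ℝ) (t : ℝ) : ℝ :=
  ∑' k : ℕ, ψ (k+1) * Real.cos ((k+1 : ℝ) * t - π * βb (k+1) / 2)

/-- The class `C^ψ_{β̄,1}` of convolutions `f = a₀/2 + (1/π) Ψ_β̄ * φ`. -/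
def ClassC (ψ βb : ℕ → ℝ) : Set (ℝ → ℝ) :=
  { f | ∃ a₀ : ℝ, ∃ φ : ℝ → ℝ, AdmPhi φ ∧
      ∀ x : ℝ, f x = a₀ / 2 + (1/π) * ∫ t in (0:ℝ)..(2*π), ker1 ψ βb (x - t) * φ t }

/-- `T` is the interpolation trigonometric polynomial `S̃_{n-1}(f)` of `f` at the
equidistant nodes `x_k^{(n-1)} = 2kπ/(2n-1)`. -/
def InterpolatesAt (n : ℕ) (T f : ℝ → ℝ) : Prop :=
  IsTrigPolyDeg (n - 1) T ∧
  ∀ k : ℤ, T (2 * (k:ℝ) * π / (2 * (n:ℝ) - 1)) = f (2 * (k:ℝ) * π / (2 * (n:ℝ) - 1))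

/-- `Ẽ_n(F)_{L_p} = sup_{f ∈ F} ‖f − S̃_{n-1}(f;·)‖_p`. -/
noncomputable def interpErr (p : ℝ≥0∞) (n : ℕ) (F : Set (ℝ → ℝ)) : ℝ :=
  sSup { e : ℝ | ∃ f ∈ F, ∃ T : ℝ → ℝ, InterpolatesAt n T f ∧
    e = LpNormPer p (fun x => f x - T x) }

/-- Dirichlet kernel. -/
noncomputable def dirK (m : ℕ) (u : ℝ) : ℝ :=
  ∑ i ∈ Finset.range (2*m+1), Real.cos (((i:ℝ) - m) * u)

/-- nodes -/
noncomputable def nd (m : ℕ) (k : ℝ) : ℝ := 2 * k * π / (2 * (m:ℝ) + 1)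

/-- interpolation operator -/
noncomputable def itp (m : ℕ) (f : ℝ → ℝ) (x : ℝ) : ℝ :=
  (1 / (2 * (m:ℝ) + 1)) * ∑ k ∈ Finset.range (2*m+1), f (nd m k) * dirK m (x - nd m k)

lemma sum_cos_dvd (N : ℕ) (hN : 0 < N) (d : ℤ) (θ : ℝ) (h : (N:ℤ) ∣ d) :
    ∑ k ∈ Finset.range N, Real.cos (2 * π * d * k / N + θ) = N * Real.cos θ := by
  obtain ⟨c, rfl⟩ := h
  have hN' : (N:ℝ) ≠ 0 := by positivity
  have : ∀ k ∈ Finset.range N, Real.cos (2 * π * ((N * c : ℤ):ℝ) * k / N + θ) = Real.cos θ := by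
    intro k _
    have e : 2 * π * ((N * c : ℤ):ℝ) * k / N + θ = θ + ((c * k : ℤ):ℝ) * (2 * π) := by
      push_cast
      field_simp
      ring
    rw [e, Real.cos_add_int_mul_two_pi]
  rw [Finset.sum_congr rfl this]
  simp

lemma sum_cos_ndvd (N : ℕ) (hN : 0 < N) (d : ℤ) (θ : ℝ) (h : ¬ (N:ℤ) ∣ d) :
    ∑ k ∈ Finset.range N, Real.cos (2 * π * d * k / N + θ) = 0 := by
  have hN' : (N:ℝ) ≠ 0 := by positivity
  have hs : Real.sin (π * d / N) ≠ 0 := by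
    intro h0
    rw [Real.sin_eq_zero_iff] at h0
    obtain ⟨c, hc⟩ := h0
    apply h
    refine ⟨c, ?_⟩
    have h1 : (c:ℝ) * N = d := by
      field_simp at hc
      linarith
    have : c * N = d := by exact_mod_cast h1
    rw [← this, mul_comm]
  have key : ∀ M : ℕ, 2 * Real.sin (π * d / N) * ∑ k ∈ Finset.range M, Real.cos (2 * π * d * k / N + θ)
      = Real.sin (2 * π * d * M / N + θ - π * d / N) - Real.sin (θ - π * d / N) := by
    intro M
    induction M with
    | zero => simp
    | succ M ih =>
      rw [Finset.sum_range_succ, mul_add, ih]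
      have e1 : 2 * π * d * ((M+1 : ℕ):ℝ) / N + θ - π * d / N
          = (2 * π * d * M / N + θ) + π * d / N := by push_cast; ring
      rw [e1, Real.sin_add, Real.sin_sub (2 * π * d * M / N + θ)]
      ring
  have h2 := key N
  have e2 : 2 * π * d * (N:ℝ) / N + θ - π * d / N = θ - π * d / N + d * (2 * π) := by
    field_simp
    ring
  rw [e2, Real.sin_add_int_mul_two_pi, sub_self] at h2
  have := mul_eq_zero.mp h2
  rcases this with h3 | h3
  · exfalso; apply hs; linarith
  · exact h3

lemma cos_mul_dirK (m : ℕ) (a u : ℝ) :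
    Real.cos a * dirK m u = ∑ i ∈ Finset.range (2*m+1), Real.cos (a + ((i:ℝ) - m) * u) := by
  have h0 : ∑ i ∈ Finset.range (2*m+1), Real.sin (((i:ℝ) - m) * u) = 0 := by
    have h := Finset.sum_range_reflect (fun i : ℕ => Real.sin (((i:ℝ) - m) * u)) (2*m+1)
    have h' : ∑ j ∈ Finset.range (2*m+1), Real.sin (((((2*m+1) - 1 - j : ℕ):ℝ) - m) * u)
        = - ∑ i ∈ Finset.range (2*m+1), Real.sin (((i:ℝ) - m) * u) := by
      rw [← Finset.sum_neg_distrib]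
      apply Finset.sum_congr rfl
      intro j hj
      rw [Finset.mem_range] at hj
      rw [← Real.sin_neg]
      congr 1
      have : (((2*m+1) - 1 - j : ℕ):ℝ) = 2 * m - j := by
        rw [Nat.cast_sub (by omega)]
        push_cast
        simp
      rw [this]; ring
    linarith
  simp_rw [Real.cos_add]
  rw [Finset.sum_sub_distrib, ← Finset.mul_sum, ← Finset.mul_sum, h0, dirK]
  ring

lemma dirK_eq (m : ℕ) (u : ℝ) :
    dirK m u = 1 + 2 * ∑ j ∈ Finset.Icc 1 m, Real.cos ((j:ℝ) * u) := by
  induction m with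
  | zero => simp [dirK]
  | succ m ih =>
    rw [Finset.sum_Icc_succ_top (by omega), mul_add, ← add_assoc, ← ih, dirK, dirK]
    rw [show 2 * (m+1) + 1 = (2 * m + 1 + 1) + 1 by ring, Finset.sum_range_succ,
      Finset.sum_range_succ']
    push_cast
    have : ∀ k : ℕ, ((k:ℝ) + 1 - (m + 1)) = k - m := by intro k; ring
    simp_rw [this]
    have e1 : ((0:ℝ) - (m+1)) * u = - ((m+1) * u) := by ring
    have e2 : (2 * (m:ℝ) + 2 - (m+1)) * u = (m+1) * u := by ring
    rw [e1, e2, Real.cos_neg]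
    ring

lemma itp_cos (m : ℕ) (M j0 : ℤ) (h1 : -(m:ℤ) ≤ j0) (h2 : j0 ≤ m)
    (hd : ((2*m+1 : ℕ):ℤ) ∣ M - j0) (θ x : ℝ) :
    itp m (fun y => Real.cos (M * y - θ)) x = Real.cos (j0 * x - θ) := by
  have hN : (2 * (m:ℝ) + 1) ≠ 0 := by positivity
  have e : ∀ k ∈ Finset.range (2*m+1), Real.cos (M * nd m k - θ) * dirK m (x - nd m k)
      = ∑ i ∈ Finset.range (2*m+1),
        Real.cos (2 * π * ((M - ((i:ℤ) - m) : ℤ) : ℝ) * k / (2*m+1 : ℕ) + (((i:ℝ) - m) * x - θ)) := by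
    intro k _
    rw [cos_mul_dirK]
    apply Finset.sum_congr rfl
    intro i _
    congr 1
    unfold nd
    push_cast
    field_simp
    ring
  rw [itp, Finset.sum_congr rfl e, Finset.sum_comm]
  rw [Finset.sum_eq_single (j0 + m).toNat]
  · have hc : (((j0 + m).toNat : ℕ) : ℤ) = j0 + m := Int.toNat_of_nonneg (by omega)
    have hc' : (((j0 + m).toNat : ℕ) : ℝ) = j0 + m := by exact_mod_cast hc
    rw [sum_cos_dvd _ (by omega)]
    · rw [hc']; push_cast; field_simp; congr 1; ring
    · rw [hc]; simpa using hd
  · intro i hi hne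
    rw [Finset.mem_range] at hi
    apply sum_cos_ndvd _ (by omega)
    intro hdv
    have h3 := dvd_sub hd hdv
    have h4 : (M - j0 - (M - ((i:ℤ) - m))) = i - m - j0 := by ring
    rw [h4] at h3
    have h5 : (i:ℤ) - m - j0 = 0 := by
      apply Int.eq_zero_of_abs_lt_dvd h3
      rw [abs_lt]; push_cast; constructor <;> omega
    apply hne; omega
  · intro h; exfalso; apply h; rw [Finset.mem_range]; omega

lemma itp_exists (m : ℕ) (M : ℤ) : ∃ j0 : ℤ, -(m:ℤ) ≤ j0 ∧ j0 ≤ m ∧ ((2*m+1 : ℕ):ℤ) ∣ M - j0 := by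
  refine ⟨(M + m) % ((2*m+1 : ℕ):ℤ) - m, ?_, ?_, ?_⟩
  · have := Int.emod_nonneg (M + m) (b := ((2*m+1 : ℕ):ℤ)) (by omega); omega
  · have := Int.emod_lt_of_pos (M + m) (b := ((2*m+1 : ℕ):ℤ)) (by omega); push_cast at *; omega
  · have := Int.dvd_self_sub_emod (x := M + m) (m := ((2*m+1 : ℕ):ℤ))
    have e : M - ((M + m) % ((2*m+1 : ℕ):ℤ) - m) = (M + m) - (M + m) % ((2*m+1 : ℕ):ℤ) := by ring
    rw [e]; exact this

lemma itp_node (m : ℕ) (f : ℝ → ℝ) (hf : Function.Periodic f (2*π)) (l : ℤ) :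
    itp m f (nd m l) = f (nd m l) := by
  have hN : (2 * (m:ℝ) + 1) ≠ 0 := by positivity
  set q := l / ((2*m+1 : ℕ):ℤ) with hq
  set s := l % ((2*m+1 : ℕ):ℤ) with hs
  have hls : l = s + ((2*m+1 : ℕ):ℤ) * q := by rw [hs, hq]; exact (Int.emod_add_mul_ediv l _).symm
  have s0 : 0 ≤ s := Int.emod_nonneg _ (by omega)
  have s1 : s < ((2*m+1 : ℕ):ℤ) := Int.emod_lt_of_pos _ (by omega)
  have hD : ∀ k : ℕ, dirK m (nd m l - nd m k) =
      ∑ i ∈ Finset.range (2*m+1), Real.cos (2 * π * ((l - k : ℤ):ℝ) * i / (2*m+1 : ℕ)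
        + (- m * (2 * π * (l - k) / (2*m+1)))) := by
    intro k
    unfold dirK
    apply Finset.sum_congr rfl
    intro i _
    congr 1
    unfold nd
    push_cast
    field_simp
    ring
  have hc : ((s.toNat : ℕ) : ℤ) = s := Int.toNat_of_nonneg s0
  rw [itp, Finset.sum_eq_single s.toNat]
  · rw [hD, sum_cos_dvd _ (by omega)]
    · have hc' : ((s.toNat : ℕ) : ℝ) = s := by exact_mod_cast hc
      have hls' : (l:ℝ) = s + (2*m+1) * q := by exact_mod_cast hls
      have e : nd m l = nd m s + q * (2 * π) := by
        unfold nd; rw [hls']; field_simp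
      have e2 : (- m * (2 * π * (l - s) / (2*m+1)) : ℝ) = 0 + ((- m * q : ℤ):ℝ) * (2 * π) := by
        rw [hls']; push_cast; field_simp; ring
      rw [hc', e2, Real.cos_add_int_mul_two_pi, Real.cos_zero, e, hf.int_mul q]
      push_cast
      field_simp
    · rw [hc, hls]; simp
  · intro k hk hne
    rw [Finset.mem_range] at hk
    rw [hD, sum_cos_ndvd _ (by omega), mul_zero]
    intro h
    apply hne
    have h3 : ((2*m+1 : ℕ):ℤ) ∣ s - k := by
      have : s - k = (l - k) - ((2*m+1 : ℕ):ℤ) * q := by rw [hls]; ring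
      rw [this]
      exact dvd_sub h (dvd_mul_right _ _)
    have h5 : s - (k:ℤ) = 0 := by
      apply Int.eq_zero_of_abs_lt_dvd h3
      rw [abs_lt]; push_cast at *; constructor <;> omega
    omega
  · intro h; exfalso; apply h; rw [Finset.mem_range]; omega

lemma itp_trig (m : ℕ) (f : ℝ → ℝ) : IsTrigPolyDeg m (itp m f) := by
  refine ⟨fun j => (1 / (2 * (m:ℝ) + 1)) * ∑ k ∈ Finset.range (2*m+1),
      f (nd m k) * (2 * Real.cos (j * nd m k)),
    fun j => (1 / (2 * (m:ℝ) + 1)) * ∑ k ∈ Finset.range (2*m+1),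
      f (nd m k) * (2 * Real.sin (j * nd m k)), ?_⟩
  intro x
  have e : ∀ k ∈ Finset.range (2*m+1), f (nd m k) * dirK m (x - nd m k) =
      f (nd m k) + ∑ j ∈ Finset.Icc 1 m, ((f (nd m k) * (2 * Real.cos (j * nd m k))) * Real.cos (j * x)
        + (f (nd m k) * (2 * Real.sin (j * nd m k))) * Real.sin (j * x)) := by
    intro k _
    rw [dirK_eq, mul_add, mul_one, Finset.mul_sum, Finset.mul_sum]
    congr 1
    apply Finset.sum_congr rfl
    intro j _
    rw [mul_sub, Real.cos_sub]; ring
  rw [itp, Finset.sum_congr rfl e, Finset.sum_add_distrib, Finset.sum_comm, mul_add]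
  congr 1
  · simp only [Nat.cast_zero, zero_mul, Real.cos_zero, mul_one]
    rw [← Finset.sum_mul]; ring
  · rw [Finset.mul_sum]
    apply Finset.sum_congr rfl
    intro j _
    rw [Finset.sum_add_distrib, ← Finset.sum_mul, ← Finset.sum_mul]; ring

lemma itp_of_trig (m : ℕ) (T : ℝ → ℝ) (h : IsTrigPolyDeg m T) (x : ℝ) : itp m T x = T x := by
  obtain ⟨a, b, hT⟩ := h
  have hc : ∀ j : ℕ, j ≤ m → ∀ θ, itp m (fun y => Real.cos (j * y - θ)) x = Real.cos (j * x - θ) := by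
    intro j hj θ
    have := itp_cos m j j (by omega) (by omega) (by simp) θ x
    simpa using this
  have h1 : itp m (fun _ => 1) x = 1 := by
    have := hc 0 (by omega) 0
    simpa using this
  have hcc : ∀ j : ℕ, j ≤ m → itp m (fun y => Real.cos (j * y)) x = Real.cos (j * x) := by
    intro j hj
    have := hc j hj 0
    simpa using this
  have hss : ∀ j : ℕ, j ≤ m → itp m (fun y => Real.sin (j * y)) x = Real.sin (j * x) := by
    intro j hj
    have := hc j hj (π/2)
    simpa [Real.cos_sub_pi_div_two] using this
  rw [hT x]
  have e : itp m T x = a 0 / 2 * itp m (fun _ => 1) x + ∑ k ∈ Finset.Icc 1 m,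
      (a k * itp m (fun y => Real.cos (k * y)) x + b k * itp m (fun y => Real.sin (k * y)) x) := by
    have e : ∀ k ∈ Finset.range (2*m+1), T (nd m k) * dirK m (x - nd m k) =
        a 0 / 2 * (1 * dirK m (x - nd m k)) + ∑ j ∈ Finset.Icc 1 m,
          (a j * (Real.cos (j * nd m k) * dirK m (x - nd m k))
            + b j * (Real.sin (j * nd m k) * dirK m (x - nd m k))) := by
      intro k _
      rw [hT, add_mul, Finset.sum_mul, one_mul]
      congr 1
      apply Finset.sum_congr rfl
      intro j _
      ring
    unfold itp
    rw [Finset.sum_congr rfl e, Finset.sum_add_distrib, Finset.sum_comm, mul_add]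
    congr 1
    · rw [← Finset.mul_sum]; ring
    · rw [Finset.mul_sum]
      apply Finset.sum_congr rfl
      intro j _
      rw [Finset.sum_add_distrib, ← Finset.mul_sum, ← Finset.mul_sum]
      ring
  rw [e, h1, mul_one]
  congr 1
  apply Finset.sum_congr rfl
  intro k hk
  rw [Finset.mem_Icc] at hk
  rw [hcc k hk.2, hss k hk.2]

lemma interp_unique (m : ℕ) (T f : ℝ → ℝ) (h : InterpolatesAt (m+1) T f) : T = itp m f := by
  funext x
  rw [← itp_of_trig m T h.1 x, itp, itp]
  congr 1
  apply Finset.sum_congr rfl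
  intro k _
  have := h.2 k
  have e : 2 * ((k:ℤ):ℝ) * π / (2 * ((m+1 : ℕ):ℝ) - 1) = nd m k := by
    unfold nd; push_cast; congr 1; ring
  rw [e] at this
  rw [this]

lemma interp_exists (m : ℕ) (f : ℝ → ℝ) (hf : Function.Periodic f (2*π)) :
    InterpolatesAt (m+1) (itp m f) f := by
  refine ⟨itp_trig m f, ?_⟩
  intro k
  have e : 2 * (k:ℝ) * π / (2 * ((m+1 : ℕ):ℝ) - 1) = nd m k := by
    unfold nd; push_cast; congr 1; ring
  rw [e]
  exact itp_node m f hf k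

lemma lp_small (p : ℝ≥0∞) (hp : 1 ≤ p) (u : ℝ → ℝ) (c : ℝ) (hc : 0 ≤ c) (h : ∀ x, |u x| ≤ c) :
    eLpNorm u p (volume.restrict (Ioc (0:ℝ) (2*π))) ≤ ENNReal.ofReal (2 * π * c) := by
  have h1 := eLpNorm_le_of_ae_bound (p := p) (μ := volume.restrict (Ioc (0:ℝ) (2*π))) (f := u) (C := c)
    (Filter.Eventually.of_forall h)
  refine h1.trans ?_
  have hpi : (1:ℝ) ≤ 2 * π := by linarith [Real.pi_gt_three]
  have hm : (volume.restrict (Ioc (0:ℝ) (2*π))) univ = ENNReal.ofReal (2*π) := by simp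
  rw [hm, ENNReal.ofReal_mul (p := 2 * π) (q := c) (by positivity)]
  gcongr
  have h2 : p.toReal⁻¹ ≤ 1 := by
    rcases eq_or_ne p ∞ with rfl | hp'
    · simp
    · apply inv_le_one_of_one_le₀
      have := ENNReal.toReal_mono hp' hp
      simpa using this
  calc ENNReal.ofReal (2*π) ^ p.toReal⁻¹ ≤ ENNReal.ofReal (2*π) ^ (1:ℝ) := by
        apply ENNReal.rpow_le_rpow_of_exponent_le _ h2
        rw [ENNReal.one_le_ofReal]; exact hpi
    _ = _ := by simp

lemma lp_sub (p : ℝ≥0∞) (hp : 1 ≤ p) (u v : ℝ → ℝ) (hu : Continuous u) (hv : Continuous v)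
    (B : ℝ) (hB : ∀ x, |v x| ≤ B)
    (c : ℝ) (h : ∀ x, |u x - v x| ≤ c) :
    |LpNormPer p u - LpNormPer p v| ≤ 2 * π * c := by
  have hc : 0 ≤ c := (abs_nonneg _).trans (h 0)
  have hB0 : 0 ≤ B := (abs_nonneg _).trans (hB 0)
  set μ := volume.restrict (Ioc (0:ℝ) (2*π)) with hμ
  have hd : eLpNorm (u - v) p μ ≤ ENNReal.ofReal (2 * π * c) := lp_small p hp _ c hc h
  have hvf : eLpNorm v p μ ≠ ∞ := ((lp_small p hp v B hB0 hB).trans_lt ENNReal.ofReal_lt_top).ne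
  have huf : eLpNorm u p μ ≠ ∞ := by
    refine ((lp_small p hp u (B + c) (by positivity) ?_).trans_lt ENNReal.ofReal_lt_top).ne
    intro x
    have h1 := abs_add_le (v x) (u x - v x)
    have h2 := h x
    have h3 := hB x
    have e : v x + (u x - v x) = u x := by ring
    rw [e] at h1
    linarith
  have hum : AEStronglyMeasurable u μ := hu.aestronglyMeasurable
  have hvm : AEStronglyMeasurable v μ := hv.aestronglyMeasurable
  have t1 : eLpNorm u p μ ≤ eLpNorm v p μ + ENNReal.ofReal (2 * π * c) := by
    have := eLpNorm_add_le hvm (hum.sub hvm) hp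
    have e : v + (u - v) = u := by abel
    rw [e] at this
    exact this.trans (by gcongr)
  have t2 : eLpNorm v p μ ≤ eLpNorm u p μ + ENNReal.ofReal (2 * π * c) := by
    have := eLpNorm_sub_le hum (hum.sub hvm) hp
    have e : u - (u - v) = v := by abel
    rw [e] at this
    exact this.trans (by gcongr)
  have hpc : 0 ≤ 2 * π * c := by positivity
  have r1 := ENNReal.toReal_mono (by simp [hvf]) t1
  have r2 := ENNReal.toReal_mono (by simp [huf]) t2
  rw [ENNReal.toReal_add hvf (by simp), ENNReal.toReal_ofReal hpc] at r1
  rw [ENNReal.toReal_add huf (by simp), ENNReal.toReal_ofReal hpc] at r2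
  unfold LpNormPer
  rw [abs_le]
  constructor <;> linarith

lemma lp_smul (p : ℝ≥0∞) (c : ℝ) (u : ℝ → ℝ) :
    LpNormPer p (fun x => c * u x) = |c| * LpNormPer p u := by
  unfold LpNormPer
  have := eLpNorm_const_smul c u p (volume.restrict (Ioc (0:ℝ) (2*π)))
  have e : (c • u) = fun x => c * u x := by funext x; simp
  rw [e] at this
  rw [this, ENNReal.toReal_mul]
  simp

lemma lp_nonneg (p : ℝ≥0∞) (u : ℝ → ℝ) : 0 ≤ LpNormPer p u := ENNReal.toReal_nonneg

lemma lp_bound (p : ℝ≥0∞) (hp : 1 ≤ p) (u : ℝ → ℝ) (c : ℝ) (hc : 0 ≤ c) (h : ∀ x, |u x| ≤ c) :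
    LpNormPer p u ≤ 2 * π * c := by
  have := ENNReal.toReal_mono (by simp) (lp_small p hp u c hc h)
  rwa [ENNReal.toReal_ofReal (by positivity)] at this

lemma lp_eq (p : ℝ≥0∞) (hp : 1 ≤ p) (hp' : p ≠ ∞) (u : ℝ → ℝ) (hu : Continuous u)
    (c : ℝ) (hc : 0 ≤ c) (h : ∀ x, |u x| ≤ c) :
    LpNormPer p u = (∫ x in (0:ℝ)..(2*π), |u x| ^ p.toReal) ^ (p.toReal)⁻¹ := by
  have hm : MemLp u p (volume.restrict (Ioc (0:ℝ) (2*π))) :=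
    ⟨hu.aestronglyMeasurable, (lp_small p hp u c hc h).trans_lt ENNReal.ofReal_lt_top⟩
  unfold LpNormPer
  rw [hm.eLpNorm_eq_integral_rpow_norm (by positivity) hp', ENNReal.toReal_ofReal,
    intervalIntegral.integral_of_le (by positivity)]
  · simp only [Real.norm_eq_abs]
  · apply Real.rpow_nonneg
    apply integral_nonneg
    intro x; positivity

lemma per_int (F : ℝ → ℝ) (hF : Continuous F) (T : ℝ) (hP : Function.Periodic F T)
    (m : ℕ) (hm : 0 < m) (c : ℝ) :
    ∫ x in (0:ℝ)..T, F (m * x + c) = ∫ x in (0:ℝ)..T, F x := by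
  have hm' : (m:ℝ) ≠ 0 := by positivity
  rw [intervalIntegral.integral_comp_mul_add F hm' c]
  have h := hP.intervalIntegral_add_zsmul_eq m c (fun a b => hF.intervalIntegrable a b)
  have e : (m:ℝ) * T + c = c + (m:ℤ) • T := by simp; ring
  have e0 : (m:ℝ) * 0 + c = c := by ring
  rw [e, e0, h, hP.intervalIntegral_add_eq c 0]
  simp
  field_simp

lemma abs_sin_sub_le (a b : ℝ) : |Real.sin a - Real.sin b| ≤ |a - b| := by
  rw [Real.sin_sub_sin]
  have h1 : |Real.sin ((a-b)/2)| ≤ |(a-b)/2| := Real.abs_sin_le_abs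
  have h2 : |Real.cos ((a+b)/2)| ≤ 1 := Real.abs_cos_le_one _
  rw [abs_mul, abs_mul, abs_of_pos (by norm_num : (0:ℝ) < 2)]
  rw [abs_div, abs_of_pos (by norm_num : (0:ℝ) < 2)] at h1
  nlinarith [abs_nonneg (Real.sin ((a-b)/2)), abs_nonneg (Real.cos ((a+b)/2))]

/-- the model error function -/
noncomputable def mdl (m : ℕ) (s x : ℝ) : ℝ :=
  Real.sin ((2*m+1) * x / 2) * Real.sin (x/2 - s)

lemma mdl_cont (m : ℕ) (s : ℝ) : Continuous (mdl m s) := by unfold mdl; fun_prop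

lemma mdl_le (m : ℕ) (s x : ℝ) : |mdl m s x| ≤ 1 := by
  unfold mdl
  rw [abs_mul]
  exact mul_le_one₀ (Real.abs_sin_le_one _) (abs_nonneg _) (Real.abs_sin_le_one _)

lemma mdl_sub (m : ℕ) (s s' x : ℝ) : |mdl m s x - mdl m s' x| ≤ |s - s'| := by
  unfold mdl
  rw [← mul_sub, abs_mul]
  have h1 := abs_sin_sub_le (x/2 - s) (x/2 - s')
  have e : x/2 - s - (x/2 - s') = -(s - s') := by ring
  rw [e, abs_neg] at h1
  have h2 := Real.abs_sin_le_one ((2*m+1) * x / 2)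
  nlinarith [abs_nonneg (Real.sin (x/2 - s) - Real.sin (x/2-s'))]

lemma abs_sin_per (x : ℝ) : |Real.sin (x + π)| = |Real.sin x| := by
  rw [Real.sin_add_pi, abs_neg]

lemma mdl_lip (p : ℝ≥0∞) (hp : 1 ≤ p) (m : ℕ) (s s' : ℝ) :
    |LpNormPer p (mdl m s) - LpNormPer p (mdl m s')| ≤ 2 * π * |s - s'| :=
  lp_sub p hp _ _ (mdl_cont m s) (mdl_cont m s') 1 (mdl_le m s') _ (mdl_sub m s s')

lemma mdl_per (p : ℝ≥0∞) (hp : 1 ≤ p) (hp' : p ≠ ∞) (m : ℕ) :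
    Function.Periodic (fun s => LpNormPer p (mdl m s)) (π / (2*m+1)) := by
  intro s
  have hN : (2 * (m:ℝ) + 1) ≠ 0 := by positivity
  show LpNormPer p (mdl m (s + π / (2*m+1))) = LpNormPer p (mdl m s)
  rw [lp_eq p hp hp' _ (mdl_cont m _) 1 zero_le_one (mdl_le m _),
    lp_eq p hp hp' _ (mdl_cont m _) 1 zero_le_one (mdl_le m _)]
  congr 1
  have hq : 0 ≤ p.toReal := ENNReal.toReal_nonneg
  have hper : Function.Periodic (fun x => |mdl m s x| ^ p.toReal) (2*π) := by
    intro x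
    show |mdl m s (x + 2*π)| ^ p.toReal = |mdl m s x| ^ p.toReal
    congr 1
    unfold mdl
    rw [abs_mul, abs_mul]
    congr 1
    · have e : (2*(m:ℝ)+1) * (x + 2*π)/2 = ((2*m+1) * x / 2 + π) + m * (2 * π) := by ring
      rw [e, Real.sin_add_nat_mul_two_pi, abs_sin_per]
    · have e : (x + 2*π)/2 - s = (x/2 - s) + π := by ring
      rw [e, abs_sin_per]
  have h1 : ∀ x, |mdl m (s + π / (2*m+1)) x| ^ p.toReal
      = (fun x => |mdl m s x| ^ p.toReal) (x + (- (2 * π / (2*m+1)))) := by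
    intro x
    show _ = |mdl m s (x + (- (2 * π / (2*m+1))))| ^ p.toReal
    congr 1
    unfold mdl
    rw [abs_mul, abs_mul]
    congr 1
    · have e : (2*(m:ℝ)+1) * x / 2 = (2*m+1) * (x + (- (2 * π / (2*m+1))))/2 + π := by
        field_simp; ring
      rw [e, abs_sin_per]
    · congr 2; field_simp; ring
  simp_rw [h1]
  rw [intervalIntegral.integral_comp_add_right (fun x => |mdl m s x| ^ p.toReal)]
  have := hper.intervalIntegral_add_eq (0 + (- (2 * π / (2*m+1)))) 0
  rw [zero_add (2 * π)] at this
  rw [← this]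
  congr 1
  ring

lemma mdl_osc (p : ℝ≥0∞) (hp : 1 ≤ p) (hp' : p ≠ ∞) (m : ℕ) (s s' : ℝ) :
    |LpNormPer p (mdl m s) - LpNormPer p (mdl m s')| ≤ 2 * π * (π / (2*m+1)) := by
  have hN : 0 < π / (2 * (m:ℝ) + 1) := by positivity
  set h := π / (2 * (m:ℝ) + 1) with hh
  have hk := (mdl_per p hp hp' m).int_mul ⌊(s' - s)/h⌋ s
  have e : LpNormPer p (mdl m s) = LpNormPer p (mdl m (s + ⌊(s' - s)/h⌋ * h)) := hk.symm
  rw [e]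
  refine (mdl_lip p hp m _ _).trans ?_
  have f1 := Int.floor_le ((s' - s)/h)
  have f2 := (Int.lt_floor_add_one ((s' - s)/h)).le
  rw [le_div_iff₀ hN] at f1
  rw [div_le_iff₀ hN] at f2
  gcongr
  rw [abs_le]; constructor <;> linarith

lemma abs_rpow_cont (u : ℝ → ℝ) (hu : Continuous u) (q : ℝ) (hq : 0 ≤ q) :
    Continuous (fun x => |u x| ^ q) := by
  apply hu.abs.rpow_const
  intro x; right; exact hq

lemma sin_pow_per (q : ℝ) : Function.Periodic (fun x => |Real.sin x| ^ q) π := by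
  intro x
  show |Real.sin (x + π)| ^ q = |Real.sin x| ^ q
  rw [abs_sin_per]

lemma sin_pow_two (q : ℝ) (hq : 0 ≤ q) :
    ∫ x in (0:ℝ)..(2*π), |Real.sin x| ^ q = 2 * ∫ x in (0:ℝ)..π, |Real.sin x| ^ q := by
  have hc := abs_rpow_cont _ Real.continuous_sin q hq
  have h := (sin_pow_per q).intervalIntegral_add_zsmul_eq 2 0 (fun a b => hc.intervalIntegrable a b)
  simpa using h

lemma cos_pow_eq (q : ℝ) (hq : 0 ≤ q) :
    ∫ x in (0:ℝ)..(2*π), |Real.cos x| ^ q = ∫ x in (0:ℝ)..(2*π), |Real.sin x| ^ q := by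
  have hc := abs_rpow_cont _ Real.continuous_sin q hq
  have hP : Function.Periodic (fun x => |Real.sin x| ^ q) (2*π) := by
    intro x
    show |Real.sin (x + 2*π)| ^ q = |Real.sin x| ^ q
    rw [Real.sin_add_two_pi]
  have h := per_int _ hc (2*π) hP 1 one_pos (π/2)
  rw [← h]
  congr 1
  funext x
  simp [Real.sin_add_pi_div_two]

lemma sin_pow_shift (q : ℝ) (hq : 0 ≤ q) (y : ℝ) :
    ∫ s in (0:ℝ)..(2*π), |Real.sin (y - s)| ^ q = ∫ x in (0:ℝ)..(2*π), |Real.sin x| ^ q := by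
  have hc := abs_rpow_cont _ Real.continuous_sin q hq
  have hP : Function.Periodic (fun x => |Real.sin x| ^ q) (2*π) := by
    intro x
    show |Real.sin (x + 2*π)| ^ q = |Real.sin x| ^ q
    rw [Real.sin_add_two_pi]
  have h := per_int _ hc (2*π) hP 1 one_pos (-y)
  rw [← h]
  congr 1
  funext x
  have e : ((1:ℕ):ℝ) * x + -y = -(y - x) := by push_cast; ring
  simp only [e, Real.sin_neg, abs_neg]

lemma sin_pow_N (q : ℝ) (hq : 0 ≤ q) (m : ℕ) :
    ∫ x in (0:ℝ)..(2*π), |Real.sin ((2*m+1) * x / 2)| ^ q = ∫ x in (0:ℝ)..(2*π), |Real.sin x| ^ q := by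
  have hc := abs_rpow_cont (fun x => Real.sin (x/2)) (by fun_prop) q hq
  have hP : Function.Periodic (fun x => |Real.sin (x/2)| ^ q) (2*π) := by
    intro x
    show |Real.sin ((x + 2*π)/2)| ^ q = |Real.sin (x/2)| ^ q
    have e : (x + 2*π)/2 = x/2 + π := by ring
    rw [e, abs_sin_per]
  have h := per_int _ hc (2*π) hP (2*m+1) (by omega) 0
  have e : ∀ x : ℝ, (((2*m+1 : ℕ):ℝ) * x + 0)/2 = (2*m+1) * x / 2 := by intro x; push_cast; ring
  simp only [e] at h
  rw [h]
  have h2 := intervalIntegral.integral_comp_div (a := 0) (b := 2*π) (fun x => |Real.sin x| ^ q) (c := 2) (by norm_num)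
  rw [h2, sin_pow_two q hq]
  simp

/-- The limit constant. -/
noncomputable def limA (p : ℝ≥0∞) : ℝ := (2*π) ^ (-(1/p.toReal)) * (cosLp p)^2

lemma mdl_fin (p : ℝ≥0∞) (hp : 1 ≤ p) (hp' : p ≠ ∞) (m : ℕ) (s : ℝ) :
    |LpNormPer p (mdl m s) - limA p| ≤ 2 * π * (π / (2*m+1)) := by
  set q := p.toReal with hqdef
  have hq1 : 1 ≤ q := by
    have := ENNReal.toReal_mono hp' hp
    simpa using this
  have hq : 0 ≤ q := by linarith
  have hq0 : q ≠ 0 := by linarith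
  set K := ∫ x in (0:ℝ)..(2*π), |Real.sin x| ^ q with hK
  have hK0 : 0 ≤ K := by
    apply intervalIntegral.integral_nonneg (by positivity)
    intro x _; positivity
  have hcos : cosLp p = K ^ q⁻¹ := by
    unfold cosLp
    rw [lp_eq p hp hp' _ Real.continuous_cos 1 zero_le_one Real.abs_cos_le_one, ← hqdef,
      cos_pow_eq q hq]
  have hA : limA p = (K^2/(2*π)) ^ q⁻¹ := by
    unfold limA
    rw [hcos, Real.div_rpow (by positivity) (by positivity), ← Real.rpow_natCast, ← Real.rpow_natCast,
      ← Real.rpow_mul hK0, ← Real.rpow_mul hK0, ← hqdef, Real.rpow_neg (by positivity)]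
    rw [mul_comm q⁻¹, one_div]
    ring
  set J : ℝ → ℝ := fun s => ∫ x in (0:ℝ)..(2*π), |mdl m s x| ^ q with hJ
  have hG : ∀ s, LpNormPer p (mdl m s) = (J s) ^ q⁻¹ := fun s =>
    lp_eq p hp hp' _ (mdl_cont m s) 1 zero_le_one (mdl_le m s)
  have hJ0 : ∀ s, 0 ≤ J s := by
    intro s
    apply intervalIntegral.integral_nonneg (by positivity)
    intro x _; positivity
  -- Fubini
  set μ := volume.restrict (Ioc (0:ℝ) (2*π)) with hμ
  have hprodInt : Integrable (Function.uncurry fun s x => |mdl m s x| ^ q) (μ.prod μ) := by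
    apply Integrable.of_bound (C := 1)
    · apply Continuous.aestronglyMeasurable
      have : Continuous (fun z : ℝ × ℝ => mdl m z.1 z.2) := by unfold mdl; fun_prop
      apply this.abs.rpow_const
      intro x; right; exact hq
    · apply Filter.Eventually.of_forall
      rintro ⟨s, x⟩
      simp only [Function.uncurry]
      rw [Real.norm_eq_abs, abs_of_nonneg (by positivity)]
      exact Real.rpow_le_one (abs_nonneg _) (mdl_le m s x) hq
  have hsw := integral_integral_swap hprodInt
  have hJμ : ∀ s, ∫ x, |mdl m s x| ^ q ∂μ = J s := by
    intro s
    rw [hJ]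
    simp only
    rw [intervalIntegral.integral_of_le (by positivity)]
  have hJi : Integrable J μ := by
    have := hprodInt.integral_prod_left
    simp only [Function.uncurry, hJμ] at this
    exact this
  have hJK : ∫ s, J s ∂μ = K^2 := by
    simp_rw [hJμ] at hsw
    rw [hsw]
    have e : ∀ x, ∫ s, |mdl m s x| ^ q ∂μ = |Real.sin ((2*m+1) * x / 2)| ^ q * K := by
      intro x
      rw [hμ, ← intervalIntegral.integral_of_le (by positivity)]
      have : ∀ s, |mdl m s x| ^ q = |Real.sin ((2*m+1) * x / 2)| ^ q * |Real.sin (x/2 - s)| ^ q := by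
        intro s
        unfold mdl
        rw [abs_mul, Real.mul_rpow (abs_nonneg _) (abs_nonneg _)]
      simp_rw [this]
      rw [intervalIntegral.integral_const_mul, sin_pow_shift q hq]
    simp_rw [e]
    rw [integral_mul_const, hμ, ← intervalIntegral.integral_of_le (by positivity), sin_pow_N q hq]
    ring
  have hv : volume (Ioc (0:ℝ) (2*π)) = ENNReal.ofReal (2*π) := by simp
  have hv0 : volume (Ioc (0:ℝ) (2*π)) ≠ 0 := by
    rw [hv]; simp [Real.pi_pos]
  have hv1 : volume (Ioc (0:ℝ) (2*π)) ≠ ∞ := by rw [hv]; exact ENNReal.ofReal_ne_top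
  have havg : ⨍ a in Ioc (0:ℝ) (2*π), J a ∂volume = K^2/(2*π) := by
    rw [setAverage_eq, hJK, measureReal_def, hv, ENNReal.toReal_ofReal (by positivity)]
    simp
    ring
  obtain ⟨s1, _, h1⟩ := exists_le_setAverage hv0 hv1 hJi
  obtain ⟨s2, _, h2⟩ := exists_setAverage_le hv0 hv1 hJi
  rw [havg] at h1 h2
  have hqi : 0 ≤ q⁻¹ := by positivity
  have g1 : LpNormPer p (mdl m s1) ≤ limA p := by
    rw [hG, hA]; exact Real.rpow_le_rpow (hJ0 _) h1 hqi
  have g2 : limA p ≤ LpNormPer p (mdl m s2) := by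
    rw [hG, hA]; exact Real.rpow_le_rpow (by positivity) h2 hqi
  have o1 := abs_le.mp (mdl_osc p hp hp' m s s1)
  have o2 := abs_le.mp (mdl_osc p hp hp' m s s2)
  rw [abs_le]; constructor <;> linarith

lemma le_lp_top (u : ℝ → ℝ) (hu : Continuous u) (hb : ∀ x, |u x| ≤ 1) (x0 : ℝ)
    (hx : x0 ∈ Ioo (0:ℝ) (2*π)) : |u x0| ≤ LpNormPer ∞ u := by
  by_contra hlt
  push Not at hlt
  set μ := volume.restrict (Ioc (0:ℝ) (2*π)) with hμ
  have hfin : eLpNorm u ∞ μ ≠ ∞ := ((lp_small ∞ le_top u 1 zero_le_one hb).trans_lt ENNReal.ofReal_lt_top).ne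
  have hae : ∀ᵐ y ∂μ, |u y| ≤ LpNormPer ∞ u := by
    have := ae_le_eLpNormEssSup (f := u) (μ := μ)
    filter_upwards [this] with y hy
    rw [← eLpNorm_exponent_top] at hy
    have := ENNReal.toReal_mono hfin hy
    simpa [LpNormPer] using this
  have hU : IsOpen (Ioo (0:ℝ) (2*π) ∩ {y | LpNormPer ∞ u < |u y|}) :=
    isOpen_Ioo.inter (isOpen_lt continuous_const hu.abs)
  have hpos : 0 < volume (Ioo (0:ℝ) (2*π) ∩ {y | LpNormPer ∞ u < |u y|}) :=
    hU.measure_pos volume ⟨x0, hx, hlt⟩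
  rw [ae_iff] at hae
  have hle : volume (Ioo (0:ℝ) (2*π) ∩ {y | LpNormPer ∞ u < |u y|}) ≤ μ {a | ¬ |u a| ≤ LpNormPer ∞ u} := by
    rw [hμ, Measure.restrict_apply']
    · apply measure_mono
      rintro y ⟨hy1, hy2⟩
      refine ⟨?_, Ioo_subset_Ioc_self hy1⟩
      simp only [mem_ofPred_eq, not_le]
      exact hy2
    · exact measurableSet_Ioc
  rw [hae] at hle
  exact absurd hpos (not_lt.mpr hle)

lemma lp_top_le (u : ℝ → ℝ) (hb : ∀ x, |u x| ≤ 1) : LpNormPer ∞ u ≤ 1 := by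
  have h1 := eLpNorm_le_of_ae_bound (p := ∞) (μ := volume.restrict (Ioc (0:ℝ) (2*π))) (f := u) (C := 1)
    (Filter.Eventually.of_forall hb)
  have := ENNReal.toReal_mono (by simp) h1
  simpa [LpNormPer] using this

lemma mdl_top (m : ℕ) (s : ℝ) :
    |LpNormPer ∞ (mdl m s) - limA ∞| ≤ 2 * π * (π / (2*m+1)) := by
  have hN : 0 < 2 * (m:ℝ) + 1 := by positivity
  have hc : cosLp ∞ = 1 := by
    apply le_antisymm (lp_top_le _ Real.abs_cos_le_one)
    have := le_lp_top _ Real.continuous_cos Real.abs_cos_le_one π ⟨Real.pi_pos, by linarith [Real.pi_pos]⟩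
    simpa using this
  have hA : limA ∞ = 1 := by unfold limA; rw [hc]; simp
  have hup := lp_top_le _ (mdl_le m s)
  -- a point `y ∈ [0, π)` with `|sin (y - s)| = 1`
  set j := ⌊(s + π/2)/π⌋ with hj
  set y := s + π/2 - j * π with hy
  have hpi := Real.pi_pos
  have y0 : 0 ≤ y := by
    have := Int.floor_le ((s + π/2)/π)
    rw [le_div_iff₀ hpi] at this
    linarith
  have y1 : y < π := by
    have := Int.lt_floor_add_one ((s + π/2)/π)
    rw [div_lt_iff₀ hpi] at this
    rw [hy, hj]; linarith
  have hsin : |Real.sin (y - s)| = 1 := by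
    have e : y - s = π/2 - j * π := by rw [hy]; ring
    rw [e, Real.sin_sub_int_mul_pi, Real.sin_pi_div_two, mul_one, abs_zpow]
    simp
  set k := ⌊(2*m+1) * y / π⌋₊ with hk
  have k1 : (k:ℝ) ≤ (2*m+1) * y / π := Nat.floor_le (by positivity)
  have k2 : (2*m+1) * y / π < k + 1 := Nat.lt_floor_add_one _
  have k3 : k < 2*m+1 := by
    have : (k:ℝ) < 2*m+1 := by
      refine k1.trans_lt ?_
      rw [div_lt_iff₀ hpi]
      gcongr
    exact_mod_cast this
  have k4 : (k:ℝ) + 1 ≤ 2*m+1 := by exact_mod_cast k3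
  rw [le_div_iff₀ hpi] at k1
  rw [div_lt_iff₀ hpi] at k2
  set x0 := (2*k+1) * π / (2*m+1) with hx0
  have hx : x0 ∈ Ioo (0:ℝ) (2*π) := by
    refine ⟨by positivity, ?_⟩
    rw [hx0, div_lt_iff₀ hN]
    nlinarith
  have hl := le_lp_top _ (mdl_cont m s) (mdl_le m s) x0 hx
  have hval : |mdl m s x0| = |Real.sin (x0/2 - s)| := by
    unfold mdl
    rw [abs_mul]
    have e : (2*(m:ℝ)+1) * x0 / 2 = π/2 + k * π := by rw [hx0]; field_simp; ring
    rw [e, Real.sin_add_nat_mul_pi]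
    simp
  have hd : |y - x0/2| ≤ π / (2*m+1) := by
    have e : y - x0/2 = ((2*m+1) * y - (k + 1/2) * π) / (2*m+1) := by rw [hx0]; field_simp
    rw [e, abs_div, abs_of_pos hN]
    gcongr
    rw [abs_le]; constructor <;> nlinarith
  have h3 := abs_sin_sub_le (y - s) (x0/2 - s)
  have e3 : y - s - (x0/2 - s) = y - x0/2 := by ring
  rw [e3] at h3
  have h4 := abs_sub_abs_le_abs_sub (Real.sin (y - s)) (Real.sin (x0/2 - s))
  have h5 : 0 ≤ π / (2*(m:ℝ)+1) := by positivity
  have h6 : π / (2*(m:ℝ)+1) ≤ 2 * π * (π / (2*m+1)) := by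
    have : 1 ≤ 2 * π := by linarith [Real.pi_gt_three]
    nlinarith
  rw [hA, abs_le]
  constructor <;> linarith

lemma mdl_main (p : ℝ≥0∞) (hp : 1 ≤ p) (m : ℕ) (s : ℝ) :
    |LpNormPer p (mdl m s) - limA p| ≤ 2 * π * (π / (2*m+1)) := by
  rcases eq_or_ne p ∞ with rfl | hp'
  · exact mdl_top m s
  · exact mdl_fin p hp hp' m s

lemma limA_eq (p : ℝ≥0∞) : 2 / π * limA p =
    2 ^ ((1:ℝ) - 1/p.toReal) / π ^ ((1:ℝ) + 1/p.toReal) * (cosLp p) ^ 2 := by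
  unfold limA
  rw [Real.mul_rpow (by norm_num) Real.pi_pos.le, Real.rpow_add Real.pi_pos,
    Real.rpow_sub (by norm_num), Real.rpow_neg (by norm_num), Real.rpow_neg Real.pi_pos.le,
    Real.rpow_one, Real.rpow_one]
  have : (0:ℝ) < π ^ (1/p.toReal) := by positivity
  field_simp

lemma psi_summable (r : ℝ) (hr : 1 < r) : Summable (fun k : ℕ => ((k+1 : ℕ):ℝ) ^ (-r)) :=
  (summable_nat_add_iff 1).mpr (Real.summable_nat_rpow.mpr (by linarith : -r < -1))

lemma ker_hasSum (r : ℝ) (hr : 1 < r) (βb : ℕ → ℝ) (t : ℝ) :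
    HasSum (fun k : ℕ => ((k+1 : ℕ):ℝ) ^ (-r) * Real.cos ((k+1 : ℝ) * t - π * βb (k+1) / 2))
      (ker1 (fun k : ℕ => (k:ℝ) ^ (-r)) βb t) := by
  apply Summable.hasSum
  apply Summable.of_norm_bounded (psi_summable r hr)
  intro k
  rw [norm_mul, Real.norm_eq_abs, Real.norm_eq_abs, abs_of_nonneg (by positivity)]
  exact mul_le_of_le_one_right (by positivity) (Real.abs_cos_le_one _)

lemma ker_cont (r : ℝ) (hr : 1 < r) (βb : ℕ → ℝ) :
    Continuous (ker1 (fun k : ℕ => (k:ℝ) ^ (-r)) βb) := by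
  unfold ker1
  apply continuous_tsum (u := fun k : ℕ => ((k+1 : ℕ):ℝ) ^ (-r)) _ (psi_summable r hr)
  · intro k t
    rw [norm_mul, Real.norm_eq_abs, Real.norm_eq_abs, abs_of_nonneg (by positivity)]
    exact mul_le_of_le_one_right (by positivity) (Real.abs_cos_le_one _)
  · intro k
    fun_prop

lemma ker_bdd (r : ℝ) (hr : 1 < r) (βb : ℕ → ℝ) (t : ℝ) :
    |ker1 (fun k : ℕ => (k:ℝ) ^ (-r)) βb t| ≤ ∑' k : ℕ, ((k+1 : ℕ):ℝ) ^ (-r) := by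
  unfold ker1
  rw [← Real.norm_eq_abs]
  apply tsum_of_norm_bounded (psi_summable r hr).hasSum
  intro k
  rw [norm_mul, Real.norm_eq_abs, Real.norm_eq_abs, abs_of_nonneg (by positivity)]
  exact mul_le_of_le_one_right (by positivity) (Real.abs_cos_le_one _)

lemma ker_per (ψ βb : ℕ → ℝ) : Function.Periodic (ker1 ψ βb) (2*π) := by
  intro t
  unfold ker1
  congr 1
  funext k
  congr 1
  have e : (k+1 : ℝ) * (t + 2*π) - π * βb (k+1) / 2
      = ((k+1 : ℝ) * t - π * βb (k+1) / 2) + ((k+1 : ℕ):ℝ) * (2*π) := by push_cast; ring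
  rw [e, Real.cos_add_nat_mul_two_pi]

lemma itp_hasSum (m : ℕ) (g : ℕ → ℝ → ℝ) (G : ℝ → ℝ) (h : ∀ y, HasSum (fun k => g k y) (G y)) (x : ℝ) :
    HasSum (fun k => itp m (g k) x) (itp m G x) := by
  unfold itp
  apply HasSum.mul_left
  apply hasSum_sum
  intro i _
  exact (h _).mul_right _

lemma itp_smul (m : ℕ) (c : ℝ) (g : ℝ → ℝ) (x : ℝ) : itp m (fun y => c * g y) x = c * itp m g x := by
  unfold itp
  simp only [mul_assoc]
  rw [← Finset.mul_sum]
  ring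

/-- interpolation error of the kernel -/
noncomputable def kerErr (m : ℕ) (r : ℝ) (βb : ℕ → ℝ) (x t : ℝ) : ℝ :=
  ker1 (fun k : ℕ => (k:ℝ) ^ (-r)) βb (x - t)
    - itp m (fun y => ker1 (fun k : ℕ => (k:ℝ) ^ (-r)) βb (y - t)) x

lemma kerErr_bound (m : ℕ) (r : ℝ) (hr : 1 < r) (βb : ℕ → ℝ) (x t : ℝ) :
    |kerErr m r βb x t + 2 * ((m+1 : ℕ):ℝ) ^ (-r) * mdl m ((m+1) * t + π * βb (m+1) / 2) x|
      ≤ 2 * ∑' k : ℕ, ((k + (m+1) + 1 : ℕ):ℝ) ^ (-r) := by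
  set θ : ℕ → ℝ := fun k => (k+1) * t + π * βb (k+1) / 2 with hθ
  set c : ℕ → ℝ → ℝ := fun k y => Real.cos (((k+1 : ℕ) : ℤ) * y - θ k) with hc
  set a : ℕ → ℝ := fun k => ((k+1 : ℕ):ℝ) ^ (-r) * (c k x - itp m (c k) x) with ha
  have hs : ∀ y, HasSum (fun k : ℕ => ((k+1 : ℕ):ℝ) ^ (-r) * c k y)
      (ker1 (fun k : ℕ => (k:ℝ) ^ (-r)) βb (y - t)) := by
    intro y
    convert ker_hasSum r hr βb (y - t) using 2 with k
    congr 1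
    simp only [hc, hθ]
    congr 1
    push_cast
    ring
  have h1 := itp_hasSum m (fun k y => ((k+1 : ℕ):ℝ) ^ (-r) * c k y) _ hs x
  simp only [itp_smul] at h1
  have hsum : HasSum a (kerErr m r βb x t) := by
    have := (hs x).sub h1
    simp only [← mul_sub] at this
    exact this
  have hlow : ∀ k, k < m → a k = 0 := by
    intro k hk
    have := itp_cos m ((k+1 : ℕ):ℤ) ((k+1 : ℕ):ℤ) (by omega) (by omega) (by simp) (θ k) x
    simp only [ha, hc]
    rw [this]; simp
  have hmid : a m = - (2 * ((m+1 : ℕ):ℝ) ^ (-r) * mdl m (θ m) x) := by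
    have := itp_cos m ((m+1 : ℕ):ℤ) (-(m:ℤ)) (by omega) (by omega) (by
      refine ⟨1, ?_⟩; push_cast; ring) (θ m) x
    simp only [ha, hc]
    rw [this, Real.cos_sub_cos]
    unfold mdl
    have e1 : ((((m+1 : ℕ):ℤ):ℝ) * x - θ m + (((-(m:ℤ) : ℤ):ℝ) * x - θ m))/2 = x/2 - θ m := by
      push_cast; ring
    have e2 : ((((m+1 : ℕ):ℤ):ℝ) * x - θ m - (((-(m:ℤ) : ℤ):ℝ) * x - θ m))/2 = (2*m+1) * x / 2 := by
      push_cast; ring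
    rw [e1, e2]
    ring
  have hhigh : ∀ k, ‖a k‖ ≤ 2 * ((k+1 : ℕ):ℝ) ^ (-r) := by
    intro k
    obtain ⟨j0, h1, h2, h3⟩ := itp_exists m ((k+1 : ℕ):ℤ)
    have := itp_cos m ((k+1 : ℕ):ℤ) j0 h1 h2 h3 (θ k) x
    simp only [ha, hc]
    rw [this, norm_mul, Real.norm_eq_abs, Real.norm_eq_abs, abs_of_nonneg (by positivity), mul_comm]
    gcongr
    refine (abs_sub _ _).trans ?_
    linarith [Real.abs_cos_le_one ((((k+1 : ℕ):ℤ):ℝ) * x - θ k), Real.abs_cos_le_one (j0 * x - θ k)]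
  have hsplit := hsum.summable.sum_add_tsum_nat_add (m+1)
  rw [hsum.tsum_eq, Finset.sum_range_succ, Finset.sum_eq_zero (fun k hk => hlow k (Finset.mem_range.mp hk)),
    zero_add, hmid] at hsplit
  have e : kerErr m r βb x t + 2 * ((m+1 : ℕ):ℝ) ^ (-r) * mdl m ((m+1) * t + π * βb (m+1) / 2) x
      = ∑' i, a (i + (m+1)) := by
    rw [← hsplit]
    simp only [hθ]
    ring
  rw [e, ← Real.norm_eq_abs]
  apply tsum_of_norm_bounded
  · apply HasSum.mul_left
    have := (summable_nat_add_iff (m+1)).mpr (psi_summable r hr)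
    exact this.hasSum
  · intro k
    exact hhigh (k + (m+1))

/-- absolute tail constant -/
noncomputable def tailM : ℝ := ∑' j : ℕ, 4 / ((j:ℝ) + 2)^2

lemma tail_summable : Summable (fun j : ℕ => 4 / ((j:ℝ) + 2)^2) := by
  have h : Summable (fun n : ℕ => 1 / (n:ℝ)^2) := Real.summable_one_div_nat_pow.mpr (by norm_num)
  have h2 := ((summable_nat_add_iff 2).mpr h).mul_left 4
  refine h2.congr (fun j => ?_)
  push_cast
  rw [mul_one_div]

lemma tail_nonneg : 0 ≤ tailM := tsum_nonneg (fun j => by positivity)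

lemma tail_bound (m : ℕ) (r : ℝ) (hr : (m:ℝ) + 2 ≤ r) :
    ((m+1 : ℕ):ℝ) ^ r * ∑' k : ℕ, ((k + (m+1) + 1 : ℕ):ℝ) ^ (-r)
      ≤ tailM * Real.exp (-r / ((m:ℝ) + 2)) := by
  have hm : (0:ℝ) ≤ m := by positivity
  have hr0 : 0 < r := by linarith
  set E := Real.exp (-r / ((m:ℝ) + 2)) with hE
  have hterm : ∀ k : ℕ, ((m+1 : ℕ):ℝ) ^ r * ((k + (m+1) + 1 : ℕ):ℝ) ^ (-r) ≤ 4 / ((k:ℝ) + 2)^2 * E := by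
    intro k
    have hk : (0:ℝ) ≤ k := by positivity
    have e1 : ((m+1 : ℕ):ℝ) ^ r * ((k + (m+1) + 1 : ℕ):ℝ) ^ (-r)
        = (((m:ℝ)+1)/(m+2)) ^ r * (1 / (1 + (k:ℝ)/(m+2)) ^ r) := by
      have : ((k + (m+1) + 1 : ℕ):ℝ) = (m+2) * (1 + (k:ℝ)/(m+2)) := by
        push_cast; field_simp; ring
      rw [this, Real.rpow_neg (by positivity), Real.mul_rpow (by positivity) (by positivity),
        Real.div_rpow (by positivity) (by positivity)]
      push_cast
      field_simp
    have e2 : (((m:ℝ)+1)/(m+2)) ^ r ≤ E := by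
      have h1 : ((m:ℝ)+1)/(m+2) ≤ Real.exp (-1/((m:ℝ)+2)) := by
        have := Real.add_one_le_exp (-1/((m:ℝ)+2))
        have e : ((m:ℝ)+1)/(m+2) = -1/((m:ℝ)+2) + 1 := by field_simp; ring
        rw [e]; exact this
      calc (((m:ℝ)+1)/(m+2)) ^ r ≤ (Real.exp (-1/((m:ℝ)+2))) ^ r :=
            Real.rpow_le_rpow (by positivity) h1 hr0.le
        _ = E := by rw [← Real.exp_mul, hE]; congr 1; ring
    have e3 : 1 / (1 + (k:ℝ)/(m+2)) ^ r ≤ 4 / ((k:ℝ) + 2)^2 := by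
      have hb := one_add_mul_self_le_rpow_one_add (s := (k:ℝ)/(m+2)) (p := r/2)
        (by have : 0 ≤ (k:ℝ)/(m+2) := by positivity
            linarith) (by linarith)
      have h2 : 1 + (k:ℝ)/2 ≤ (1 + (k:ℝ)/(m+2)) ^ (r/2) := by
        refine le_trans ?_ hb
        have : (k:ℝ)/2 = ((m:ℝ)+2)/2 * (k/(m+2)) := by field_simp
        rw [this]
        gcongr
      have h3 : (1 + (k:ℝ)/2)^2 ≤ (1 + (k:ℝ)/(m+2)) ^ r := by
        have e : (1 + (k:ℝ)/(m+2)) ^ r = ((1 + (k:ℝ)/(m+2)) ^ (r/2))^2 := by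
          rw [← Real.rpow_natCast, ← Real.rpow_mul (by positivity)]
          congr 1; push_cast; ring
        rw [e]
        gcongr
      have e4 : 4 / ((k:ℝ) + 2)^2 = 1 / (1 + (k:ℝ)/2)^2 := by field_simp; ring
      rw [e4]
      gcongr
    rw [e1, mul_comm]
    gcongr
  have hs : Summable (fun k : ℕ => ((k + (m+1) + 1 : ℕ):ℝ) ^ (-r)) :=
    (summable_nat_add_iff (m+1)).mpr (psi_summable r (by linarith))
  rw [← tsum_mul_left, tailM, ← tsum_mul_right]
  exact (hs.mul_left _).tsum_le_tsum hterm (tail_summable.mul_right _)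

lemma err_repr (m : ℕ) (r : ℝ) (hr : 1 < r) (βb : ℕ → ℝ) (φ f : ℝ → ℝ) (a₀ : ℝ)
    (hφ : IntervalIntegrable φ volume 0 (2*π))
    (hf : ∀ x : ℝ, f x = a₀ / 2 + (1/π) * ∫ t in (0:ℝ)..(2*π),
      ker1 (fun k : ℕ => (k:ℝ) ^ (-r)) βb (x - t) * φ t) (x : ℝ) :
    IntervalIntegrable (fun t => kerErr m r βb x t * φ t) volume 0 (2*π) ∧
    f x - itp m f x = (1/π) * ∫ t in (0:ℝ)..(2*π), kerErr m r βb x t * φ t := by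
  set κ := ker1 (fun k : ℕ => (k:ℝ) ^ (-r)) βb with hκ
  have hκc : Continuous κ := ker_cont r hr βb
  have hI : ∀ y, IntervalIntegrable (fun t => κ (y - t) * φ t) volume 0 (2*π) := by
    intro y
    exact hφ.continuousOn_mul (by fun_prop : Continuous fun t => κ (y - t)).continuousOn
  have h1 : (1 / (2 * (m:ℝ) + 1)) * ∑ k ∈ Finset.range (2*m+1), dirK m (x - nd m k) = 1 := by
    have := itp_cos m 0 0 (by omega) (by omega) (by simp) 0 x
    unfold itp at this
    simpa using this
  have e : ∀ t, kerErr m r βb x t * φ t = κ (x - t) * φ t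
      - ∑ k ∈ Finset.range (2*m+1), (1 / (2 * (m:ℝ) + 1) * dirK m (x - nd m k)) * (κ (nd m k - t) * φ t) := by
    intro t
    unfold kerErr itp
    rw [sub_mul, Finset.mul_sum, Finset.sum_mul]
    congr 1
    apply Finset.sum_congr rfl
    intro k _
    ring
  have hS : ∀ k ∈ Finset.range (2*m+1), IntervalIntegrable (fun t =>
      (1 / (2 * (m:ℝ) + 1) * dirK m (x - nd m k)) * (κ (nd m k - t) * φ t)) volume 0 (2*π) :=
    fun k _ => (hI _).const_mul _
  have hSS : IntervalIntegrable (fun t => ∑ k ∈ Finset.range (2*m+1),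
      (1 / (2 * (m:ℝ) + 1) * dirK m (x - nd m k)) * (κ (nd m k - t) * φ t)) volume 0 (2*π) := by
    have := IntervalIntegrable.sum (Finset.range (2*m+1)) hS
    have e3 : (fun t => ∑ k ∈ Finset.range (2*m+1),
        (1 / (2 * (m:ℝ) + 1) * dirK m (x - nd m k)) * (κ (nd m k - t) * φ t))
        = ∑ k ∈ Finset.range (2*m+1), fun t =>
        (1 / (2 * (m:ℝ) + 1) * dirK m (x - nd m k)) * (κ (nd m k - t) * φ t) := by
      funext t
      rw [Finset.sum_apply]
    rw [e3]
    exact this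
  simp_rw [e]
  refine ⟨(hI x).sub hSS, ?_⟩
  rw [intervalIntegral.integral_sub (hI x) hSS, intervalIntegral.integral_finsetSum hS]
  simp_rw [intervalIntegral.integral_const_mul]
  have e2 : itp m f x = a₀/2 + (1/π) * ∑ k ∈ Finset.range (2*m+1), (1 / (2 * (m:ℝ) + 1) * dirK m (x - nd m k)) *
      ∫ t in (0:ℝ)..(2*π), κ (nd m k - t) * φ t := by
    unfold itp
    simp_rw [hf, add_mul]
    rw [Finset.sum_add_distrib, ← Finset.mul_sum, mul_add]
    congr 1
    · linear_combination (a₀/2) * h1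
    · rw [Finset.mul_sum, Finset.mul_sum]
      apply Finset.sum_congr rfl
      intro k _
      ring
  rw [e2, hf x]
  ring

lemma f_cont (r : ℝ) (hr : 1 < r) (βb : ℕ → ℝ) (φ f : ℝ → ℝ) (a₀ : ℝ)
    (hφ : IntervalIntegrable φ volume 0 (2*π))
    (hf : ∀ x : ℝ, f x = a₀ / 2 + (1/π) * ∫ t in (0:ℝ)..(2*π),
      ker1 (fun k : ℕ => (k:ℝ) ^ (-r)) βb (x - t) * φ t) : Continuous f := by
  have hκc := ker_cont r hr βb
  have : f = fun x => a₀ / 2 + (1/π) * ∫ t in (0:ℝ)..(2*π),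
      ker1 (fun k : ℕ => (k:ℝ) ^ (-r)) βb (x - t) * φ t := funext hf
  rw [this]
  apply continuous_const.add
  apply continuous_const.mul
  apply intervalIntegral.continuous_of_dominated_interval
    (bound := fun t => (∑' k : ℕ, ((k+1 : ℕ):ℝ) ^ (-r)) * |φ t|)
  · intro x
    have : IntervalIntegrable (fun t => ker1 (fun k : ℕ => (k:ℝ) ^ (-r)) βb (x - t) * φ t) volume 0 (2*π) :=
      hφ.continuousOn_mul (by fun_prop : Continuous fun t => ker1 (fun k : ℕ => (k:ℝ) ^ (-r)) βb (x - t)).continuousOn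
    exact (intervalIntegrable_iff.mp this).aestronglyMeasurable
  · intro x
    apply Filter.Eventually.of_forall
    intro t _
    rw [norm_mul, Real.norm_eq_abs, Real.norm_eq_abs]
    gcongr
    exact ker_bdd r hr βb _
  · exact hφ.abs.const_mul _
  · apply Filter.Eventually.of_forall
    intro t _
    fun_prop

lemma itp_cont (m : ℕ) (f : ℝ → ℝ) : Continuous (itp m f) := by
  unfold itp dirK; fun_prop

lemma core (p : ℝ≥0∞) (hp : 1 ≤ p) (m : ℕ) (r : ℝ) (hr : (m:ℝ) + 2 ≤ r) (βb : ℕ → ℝ)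
    (φ f : ℝ → ℝ) (a₀ : ℝ) (hφ : AdmPhi φ)
    (hf : ∀ x : ℝ, f x = a₀ / 2 + (1/π) * ∫ t in (0:ℝ)..(2*π),
      ker1 (fun k : ℕ => (k:ℝ) ^ (-r)) βb (x - t) * φ t) :
    ∃ ρ δ : ℝ, 0 ≤ ρ ∧ ρ ≤ 1 ∧
      (∫ t in (0:ℝ)..(2*π), Real.sin ((m+1) * t + π * βb (m+1) / 2) * φ t) ≤ ρ ∧
      |((m+1 : ℕ):ℝ) ^ r * LpNormPer p (fun x => f x - itp m f x)
        - 2 / π * ρ * LpNormPer p (mdl m δ)| ≤ 4 * tailM * Real.exp (-r / ((m:ℝ) + 2)) := by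
  have hm : (0:ℝ) ≤ m := by positivity
  have hr1 : 1 < r := by linarith
  have hpi := Real.pi_pos
  have h2pi : (0:ℝ) ≤ 2 * π := by positivity
  obtain ⟨-, hφi, -, hφ1⟩ := hφ
  have hφI : IntervalIntegrable φ volume 0 (2*π) :=
    (intervalIntegrable_iff_integrableOn_Ioc_of_le h2pi).mpr hφi
  set γ := π * βb (m+1) / 2 with hγ
  have hmulI : ∀ g : ℝ → ℝ, Continuous g → IntervalIntegrable (fun t => g t * φ t) volume 0 (2*π) :=
    fun g hg => hφI.continuousOn_mul hg.continuousOn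
  set a := ∫ t in (0:ℝ)..(2*π), Real.cos ((m+1) * t + γ) * φ t with ha
  set b := ∫ t in (0:ℝ)..(2*π), Real.sin ((m+1) * t + γ) * φ t with hb
  have hcI := hmulI (fun t => Real.cos ((m+1) * t + γ)) (by fun_prop)
  have hsI := hmulI (fun t => Real.sin ((m+1) * t + γ)) (by fun_prop)
  set z : ℂ := ⟨a, b⟩ with hz
  set ρ := ‖z‖ with hρ
  set δ := z.arg with hδ
  have hac : ρ * Real.cos δ = a := Complex.norm_mul_cos_arg z
  have hbs : ρ * Real.sin δ = b := Complex.norm_mul_sin_arg z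
  have hρ0 : 0 ≤ ρ := norm_nonneg _
  -- a bound for integrals against φ
  have hbd : ∀ g : ℝ → ℝ, IntervalIntegrable (fun t => g t * φ t) volume 0 (2*π) → ∀ c, 0 ≤ c →
      (∀ t, |g t| ≤ c) → |∫ t in (0:ℝ)..(2*π), g t * φ t| ≤ c := by
    intro g hg c hc h
    calc |∫ t in (0:ℝ)..(2*π), g t * φ t| ≤ ∫ t in (0:ℝ)..(2*π), |g t * φ t| :=
          intervalIntegral.abs_integral_le_integral_abs h2pi
      _ ≤ ∫ t in (0:ℝ)..(2*π), c * |φ t| := by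
          apply intervalIntegral.integral_mono_on h2pi hg.abs (hφI.abs.const_mul c)
          intro t _
          rw [abs_mul]
          exact mul_le_mul_of_nonneg_right (h t) (abs_nonneg _)
      _ = c * ∫ t in (0:ℝ)..(2*π), |φ t| := intervalIntegral.integral_const_mul _ _
      _ ≤ c := mul_le_of_le_one_right hc hφ1
  have hρe : ρ = ∫ t in (0:ℝ)..(2*π), Real.cos ((m+1) * t + γ - δ) * φ t := by
    have e : ∀ t, Real.cos ((m+1) * t + γ - δ) * φ t = Real.cos δ * (Real.cos ((m+1) * t + γ) * φ t)
        + Real.sin δ * (Real.sin ((m+1) * t + γ) * φ t) := by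
      intro t; rw [Real.cos_sub]; ring
    simp_rw [e]
    rw [intervalIntegral.integral_add (hcI.const_mul _) (hsI.const_mul _),
      intervalIntegral.integral_const_mul, intervalIntegral.integral_const_mul, ← ha, ← hb, ← hac, ← hbs]
    linear_combination (-ρ) * Real.sin_sq_add_cos_sq δ
  have hρ1 : ρ ≤ 1 := by
    rw [hρe]
    refine (le_abs_self _).trans ?_
    exact hbd _ (hmulI (fun t => Real.cos ((m+1) * t + γ - δ)) (by fun_prop)) 1 zero_le_one
      (fun t => Real.abs_cos_le_one _)
  have hmdl : ∀ x, ∫ t in (0:ℝ)..(2*π), mdl m ((m+1) * t + γ) x * φ t = ρ * mdl m δ x := by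
    intro x
    have e : ∀ t, mdl m ((m+1) * t + γ) x * φ t =
        (Real.sin ((2*m+1) * x / 2) * Real.sin (x/2)) * (Real.cos ((m+1) * t + γ) * φ t)
        - (Real.sin ((2*m+1) * x / 2) * Real.cos (x/2)) * (Real.sin ((m+1) * t + γ) * φ t) := by
      intro t; unfold mdl; rw [Real.sin_sub]; ring
    simp_rw [e]
    rw [intervalIntegral.integral_sub (hcI.const_mul _) (hsI.const_mul _),
      intervalIntegral.integral_const_mul, intervalIntegral.integral_const_mul, ← ha, ← hb, ← hac, ← hbs]
    unfold mdl
    rw [Real.sin_sub]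
    ring
  set τ := ∑' k : ℕ, ((k + (m+1) + 1 : ℕ):ℝ) ^ (-r) with hτ
  have hτ0 : 0 ≤ τ := tsum_nonneg (fun k => by positivity)
  set w := ((m+1 : ℕ):ℝ) ^ (-r) with hw
  have hw0 : 0 < w := by positivity
  have hpt : ∀ x, |(f x - itp m f x) - (-(2/π * ρ * w)) * mdl m δ x| ≤ 2 / π * τ := by
    intro x
    obtain ⟨hi, he⟩ := err_repr m r hr1 βb φ f a₀ hφI hf x
    have hmi := hmulI (fun t => mdl m ((m+1) * t + γ) x) (by unfold mdl; fun_prop)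
    have e : ∀ t, (kerErr m r βb x t + 2 * w * mdl m ((m+1) * t + γ) x) * φ t
        = kerErr m r βb x t * φ t + (2 * w) * (mdl m ((m+1) * t + γ) x * φ t) := by intro t; ring
    have hi2 : IntervalIntegrable (fun t => (kerErr m r βb x t + 2 * w * mdl m ((m+1) * t + γ) x) * φ t)
        volume 0 (2*π) := by
      simp_rw [e]
      exact hi.add (hmi.const_mul _)
    have h := hbd _ hi2 (2 * τ) (by positivity) (fun t => kerErr_bound m r hr1 βb x t)
    simp_rw [e] at h
    rw [intervalIntegral.integral_add hi (hmi.const_mul _), intervalIntegral.integral_const_mul, hmdl] at h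
    have e5 : (f x - itp m f x) - (-(2/π * ρ * w)) * mdl m δ x
        = (1/π) * ((∫ t in (0:ℝ)..(2*π), kerErr m r βb x t * φ t) + 2 * w * (ρ * mdl m δ x)) := by
      rw [he]; ring
    rw [e5, abs_mul, abs_of_pos (by positivity : 0 < 1/π)]
    calc 1/π * _ ≤ 1/π * (2 * τ) := by gcongr
      _ = 2/π * τ := by ring
  have hfc := f_cont r hr1 βb φ f a₀ hφI hf
  have hL := lp_sub p hp (fun x => f x - itp m f x) (fun x => (-(2/π * ρ * w)) * mdl m δ x)
    (hfc.sub (itp_cont m f)) (continuous_const.mul (mdl_cont m δ)) (2/π * ρ * w)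
    (by
      intro x
      rw [abs_mul, abs_neg, abs_of_nonneg (by positivity : 0 ≤ 2/π * ρ * w)]
      exact mul_le_of_le_one_right (by positivity) (mdl_le m δ x))
    (2/π * τ) hpt
  rw [lp_smul, abs_neg, abs_of_nonneg (by positivity : 0 ≤ 2/π * ρ * w)] at hL
  refine ⟨ρ, δ, hρ0, hρ1, ?_, ?_⟩
  · rw [← hbs]
    exact mul_le_of_le_one_right hρ0 (Real.sin_le_one _)
  · set W := ((m+1 : ℕ):ℝ) ^ r with hW
    have hW0 : 0 < W := by positivity
    have hWw : W * w = 1 := by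
      rw [hW, hw, Real.rpow_neg (by positivity)]
      exact mul_inv_cancel₀ hW0.ne'
    have e6 : W * LpNormPer p (fun x => f x - itp m f x) - 2 / π * ρ * LpNormPer p (mdl m δ)
        = W * (LpNormPer p (fun x => f x - itp m f x) - 2/π * ρ * w * LpNormPer p (mdl m δ)) := by
      linear_combination (2 / π * ρ * LpNormPer p (mdl m δ)) * hWw
    rw [e6, abs_mul, abs_of_pos hW0]
    calc W * _ ≤ W * (2 * π * (2/π * τ)) := by gcongr
      _ = 4 * (W * τ) := by field_simp; ring
      _ ≤ 4 * (tailM * Real.exp (-r / ((m:ℝ) + 2))) :=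
          mul_le_mul_of_nonneg_left (tail_bound m r hr) (by norm_num)
      _ = _ := by ring

lemma sin_odd_int (N : ℕ) : ∫ x in (0:ℝ)..(2*π), Real.sin x ^ (2*N+1) = 0 := by
  have hc : Continuous (fun x => Real.sin x ^ (2*N+1)) := by fun_prop
  have hP : Function.Periodic (fun x => Real.sin x ^ (2*N+1)) (2*π) := by
    intro x; simp
  have h := per_int _ hc (2*π) hP 1 one_pos π
  have e : ∀ x, Real.sin (((1:ℕ):ℝ) * x + π) ^ (2*N+1) = - (Real.sin x ^ (2*N+1)) := by
    intro x
    rw [Nat.cast_one, one_mul, Real.sin_add_pi, Odd.neg_pow ⟨N, rfl⟩]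
  simp_rw [e] at h
  rw [intervalIntegral.integral_neg] at h
  linarith

lemma sin_abs_int (k : ℕ) :
    ∫ x in (0:ℝ)..(2*π), |Real.sin x| ^ k = 2 * ∫ x in (0:ℝ)..π, Real.sin x ^ k := by
  have h := sin_pow_two (k:ℝ) (by positivity)
  simp_rw [Real.rpow_natCast] at h
  rw [h]
  congr 1
  apply intervalIntegral.integral_congr
  intro x hx
  rw [uIcc_of_le Real.pi_pos.le] at hx
  simp only
  rw [abs_of_nonneg (Real.sin_nonneg_of_mem_Icc hx)]

/-- A nearly extremal `φ`. -/
lemma ext_phi (m : ℕ) (γ : ℝ) : ∃ φ : ℝ → ℝ, AdmPhi φ ∧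
    1 - 1/((m:ℝ)+1) ≤ ∫ t in (0:ℝ)..(2*π), Real.sin ((m+1) * t + γ) * φ t := by
  set I := ∫ x in (0:ℝ)..π, Real.sin x ^ (2*m+1) with hI
  have hI0 : 0 < I := integral_sin_pow_pos _
  set c := (2 * I)⁻¹ with hc
  have hc0 : 0 < c := by positivity
  have hcast : ∀ t : ℝ, ((m:ℝ)+1) * t + γ = ((m+1 : ℕ):ℝ) * t + γ := by intro t; push_cast; ring
  refine ⟨fun t => c * Real.sin ((m+1) * t + γ) ^ (2*m+1), ⟨?_, ?_, ?_, ?_⟩, ?_⟩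
  · intro t
    have e : ((m:ℝ)+1) * (t + 2*π) + γ = ((m+1) * t + γ) + ((m+1 : ℕ):ℝ) * (2*π) := by push_cast; ring
    simp only
    rw [e, Real.sin_add_nat_mul_two_pi]
  · have : Continuous (fun t => c * Real.sin ((m+1) * t + γ) ^ (2*m+1)) := by fun_prop
    exact this.integrableOn_Ioc
  · rw [intervalIntegral.integral_const_mul]
    simp_rw [hcast]
    rw [per_int (fun x => Real.sin x ^ (2*m+1)) (by fun_prop) (2*π) (by intro x; simp) (m+1) (by omega) γ,
      sin_odd_int, mul_zero]
  · have e : ∀ t, |c * Real.sin ((m+1) * t + γ) ^ (2*m+1)| = c * |Real.sin (((m+1 : ℕ):ℝ) * t + γ)| ^ (2*m+1) := by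
      intro t; rw [abs_mul, abs_of_pos hc0, abs_pow, hcast]
    beta_reduce
    rw [intervalIntegral.integral_congr (fun t _ => e t)]
    rw [intervalIntegral.integral_const_mul,
      per_int (fun x => |Real.sin x| ^ (2*m+1)) (by fun_prop) (2*π) (by intro x; simp) (m+1) (by omega) γ,
      sin_abs_int, ← hI, hc]
    exact (inv_mul_cancel₀ (by positivity)).le
  · have e : ∀ t, Real.sin ((m+1) * t + γ) * (c * Real.sin ((m+1) * t + γ) ^ (2*m+1))
        = c * |Real.sin (((m+1 : ℕ):ℝ) * t + γ)| ^ (2*m+2) := by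
      intro t
      rw [hcast, Even.pow_abs ⟨m+1, by ring⟩]; ring
    beta_reduce
    rw [intervalIntegral.integral_congr (fun t _ => e t)]
    rw [intervalIntegral.integral_const_mul,
      per_int (fun x => |Real.sin x| ^ (2*m+2)) (by fun_prop) (2*π) (by intro x; simp) (m+1) (by omega) γ,
      sin_abs_int]
    have h1 : ∫ x in (0:ℝ)..π, Real.sin x ^ (2*m+1+2) ≤ ∫ x in (0:ℝ)..π, Real.sin x ^ (2*m+2) :=
      integral_sin_pow_antitone (by omega)
    rw [integral_sin_pow] at h1
    simp only [Real.sin_zero, Real.sin_pi] at h1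
    rw [← hI] at h1
    have h2 : (1 - 1/((m:ℝ)+1)) * I ≤ ∫ x in (0:ℝ)..π, Real.sin x ^ (2*m+2) := by
      refine le_trans ?_ h1
      have h3 : (1 - 1/((m:ℝ)+1)) ≤ (((2*m+1 : ℕ):ℝ) + 1) / (((2*m+1 : ℕ):ℝ) + 2) := by
        have hm : (0:ℝ) ≤ m := by positivity
        push_cast
        rw [le_div_iff₀ (by positivity), sub_mul, div_mul_eq_mul_div, sub_le_iff_le_add]
        have : 1 ≤ 1 * (2 * (m:ℝ) + 1 + 2) / (m+1) := by
          rw [le_div_iff₀ (by positivity)]; linarith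
        linarith
      have := mul_le_mul_of_nonneg_right h3 hI0.le
      simpa using this
    have h4 : 1 - 1/((m:ℝ)+1) = c * (2 * ((1 - 1/((m:ℝ)+1)) * I)) := by
      rw [hc]; field_simp
    rw [h4]
    gcongr

lemma f_per (ψ βb : ℕ → ℝ) (φ : ℝ → ℝ) (a₀ : ℝ) :
    Function.Periodic (fun x => a₀ / 2 + (1/π) * ∫ t in (0:ℝ)..(2*π), ker1 ψ βb (x - t) * φ t) (2*π) := by
  intro x
  have e : ∀ t, ker1 ψ βb (x + 2*π - t) = ker1 ψ βb (x - t) := by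
    intro t
    have : x + 2*π - t = (x - t) + 2*π := by ring
    rw [this, ker_per ψ βb]
  simp only [e]

/-- **Estimate (54).** For `r ≥ n+1`:
`|n^r Ẽ_n(W^r_{β̄,1})_{L_p} − (2^{1−1/p}/π^{1+1/p})‖cos‖_p²| ≤ C(1/n + e^{−r/(n+1)})`. -/
theorem statement4 :
    ∃ C : ℝ, 0 < C ∧ ∀ (p : ℝ≥0∞), 1 ≤ p → ∀ (βb : ℕ → ℝ), ∀ (r : ℝ), 1 < r →
      ∀ n : ℕ, 1 ≤ n → (n:ℝ) + 1 ≤ r →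
        |(n:ℝ) ^ r * interpErr p n (ClassC (fun k : ℕ => (k:ℝ) ^ (-r)) βb) -
            2 ^ ((1:ℝ) - 1/p.toReal) / π ^ ((1:ℝ) + 1/p.toReal) * (cosLp p) ^ 2| ≤
          C * (1/n + Real.exp (-r / ((n:ℝ)+1))) := by
  have hpi := Real.pi_pos
  have hM := tail_nonneg
  refine ⟨4 * tailM + 4 * π + 4, by positivity, ?_⟩
  intro p hp βb r hr n hn hnr
  obtain ⟨m, rfl⟩ : ∃ m, n = m + 1 := ⟨n - 1, by omega⟩
  have hr2 : (m:ℝ) + 2 ≤ r := by push_cast at hnr; linarith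
  rw [← limA_eq]
  have hexp : Real.exp (-r / (((m+1 : ℕ):ℝ)+1)) = Real.exp (-r / ((m:ℝ) + 2)) := by
    congr 2; push_cast; ring
  rw [hexp]
  set E := Real.exp (-r / ((m:ℝ) + 2)) with hE
  have hE0 : 0 < E := Real.exp_pos _
  set W := ((m+1 : ℕ):ℝ) ^ r with hW
  have hW0 : 0 < W := by positivity
  set A := limA p with hA
  set h := 1 / ((m+1 : ℕ):ℝ) with hh
  have hh0 : 0 < h := by positivity
  have hmain : ∀ s, |LpNormPer p (mdl m s) - A| ≤ 2 * π * (π * h) := by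
    intro s
    refine (mdl_main p hp m s).trans ?_
    have : π / (2*(m:ℝ)+1) ≤ π * h := by
      rw [hh, mul_one_div]
      gcongr
      push_cast
      linarith [(by positivity : (0:ℝ) ≤ m)]
    gcongr
  have hG1 : ∀ s, LpNormPer p (mdl m s) ≤ 2 * π := by
    intro s
    have := lp_bound p hp (mdl m s) 1 zero_le_one (mdl_le m s)
    linarith
  have hA0 : 0 ≤ A := by rw [hA]; unfold limA; positivity
  -- the set
  set S := { e : ℝ | ∃ f ∈ ClassC (fun k : ℕ => (k:ℝ) ^ (-r)) βb, ∃ T : ℝ → ℝ, InterpolatesAt (m+1) T f ∧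
    e = LpNormPer p (fun x => f x - T x) } with hS
  have hupper : ∀ e ∈ S, W * e ≤ 2 / π * A + 4 * π * h + 4 * tailM * E := by
    rintro e ⟨f, ⟨a₀, φ, hφ, hf⟩, T, hT, rfl⟩
    rw [interp_unique m T f hT]
    obtain ⟨ρ, δ, h0, h1, -, h3⟩ := core p hp m r hr2 βb φ f a₀ hφ hf
    have h4 := (abs_le.mp h3).2
    have h5 := (abs_le.mp (hmain δ)).2
    have h6 : 2 / π * ρ * LpNormPer p (mdl m δ) ≤ 2 / π * A + 4 * π * h := by
      calc 2 / π * ρ * LpNormPer p (mdl m δ) ≤ 2 / π * 1 * LpNormPer p (mdl m δ) := by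
            have := lp_nonneg p (mdl m δ)
            gcongr
        _ ≤ 2 / π * 1 * (A + 2 * π * (π * h)) := by gcongr; linarith
        _ = _ := by field_simp; ring
    linarith
  have hbdd : BddAbove S := by
    refine ⟨(2 / π * A + 4 * π * h + 4 * tailM * E) / W, ?_⟩
    intro e he
    rw [le_div_iff₀ hW0, mul_comm]
    exact hupper e he
  -- the extremal function
  obtain ⟨φ, hφ, hφe⟩ := ext_phi m (π * βb (m+1) / 2)
  set f : ℝ → ℝ := fun x => 0 / 2 + (1/π) * ∫ t in (0:ℝ)..(2*π),
      ker1 (fun k : ℕ => (k:ℝ) ^ (-r)) βb (x - t) * φ t with hfdef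
  have hfm : LpNormPer p (fun x => f x - itp m f x) ∈ S :=
    ⟨f, ⟨0, φ, hφ, fun x => rfl⟩, itp m f, interp_exists m f (f_per _ _ _ _), rfl⟩
  obtain ⟨ρ, δ, h0, h1, h2, h3⟩ := core p hp m r hr2 βb φ f 0 hφ (fun x => rfl)
  have hle : LpNormPer p (fun x => f x - itp m f x) ≤ sSup S := le_csSup hbdd hfm
  have hsup : sSup S ≤ (2 / π * A + 4 * π * h + 4 * tailM * E) / W := by
    apply csSup_le ⟨_, hfm⟩
    intro e he
    rw [le_div_iff₀ hW0, mul_comm]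
    exact hupper e he
  rw [le_div_iff₀ hW0] at hsup
  have hρh : 1 - h ≤ ρ := by
    refine le_trans (le_of_eq ?_) (hφe.trans h2)
    rw [hh]; push_cast; ring
  have hlow : 2 / π * A - 4 * π * h - 4 * h - 4 * tailM * E ≤ W * sSup S := by
    have h4 := (abs_le.mp h3).1
    have h5 := (abs_le.mp (hmain δ)).1
    have h6 : W * LpNormPer p (fun x => f x - itp m f x) ≤ W * sSup S := by gcongr
    have h7 : 2 / π * A - 4 * π * h - 4 * h ≤ 2 / π * ρ * LpNormPer p (mdl m δ) := by
      calc 2 / π * A - 4 * π * h - 4 * h = 2 / π * (A - 2 * π * (π * h)) - 2 / π * h * (2 * π) := by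
            field_simp; ring
        _ ≤ 2 / π * LpNormPer p (mdl m δ) - 2 / π * h * LpNormPer p (mdl m δ) := by
            have := hG1 δ
            gcongr
            linarith
        _ = 2 / π * (1 - h) * LpNormPer p (mdl m δ) := by ring
        _ ≤ _ := by
            have := lp_nonneg p (mdl m δ)
            gcongr
    linarith
  have hI : interpErr p (m+1) (ClassC (fun k : ℕ => (k:ℝ) ^ (-r)) βb) = sSup S := rfl
  rw [hI, abs_le]
  have hhE : 0 ≤ tailM * h := by positivity
  have h8 : 0 ≤ π * E := by positivity
  have h9 : 0 ≤ π * h := by positivity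
  constructor <;> nlinarith
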